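/- For every positive integer n and every Boolean function f : {-1,1}^n → {-1,1} with k(f) ≥ 2, the Fourier max-supp-entropy satisfies √(k(f)) ≤ k'(f) ≤ k(f)/2. -/

import Mathlib

open scoped BigOperators
open scoped Classical

noncomputable section

namespace BoolFunc

/-- Real value of a hypercube coordinate: `true ↦ -1`, `false ↦ 1`. -/
def signv (b : Bool) : ℝ := if b then -1 else 1

/-- Fourier coefficient `f̂(S)` of `f : {-1,1}ⁿ → ℝ`. -/
def fourierCoeff {n : ℕ} (f : (Fin n → Bool) → ℝ) (S : Finset (Fin n)) : ℝ :=
  (∑ x : Fin n → Bool, f x * ∏ i ∈ S, signv (x i)) / 2 ^ n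

/-- Fourier support of `f`. -/
def fourierSupport {n : ℕ} (f : (Fin n → Bool) → ℝ) : Finset (Finset (Fin n)) :=
  Finset.univ.filter (fun S => fourierCoeff f S ≠ 0)

/-- Fourier sparsity `k(f)`. -/
def sparsity {n : ℕ} (f : (Fin n → Bool) → ℝ) : ℕ := (fourierSupport f).card

/-- Indicator vector in `F₂ⁿ` of a subset of `[n]`. -/
def indicatorVec {n : ℕ} (S : Finset (Fin n)) : Fin n → ZMod 2 :=
  fun i => if i ∈ S then 1 else 0

/-- Fourier rank `r(f)`: the `F₂`-dimension of the span of the Fourier support. -/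
def fourierRank {n : ℕ} (f : (Fin n → Bool) → ℝ) : ℕ :=
  Module.finrank (ZMod 2)
    ↥(Submodule.span (ZMod 2)
      (indicatorVec '' (fourierSupport f : Set (Finset (Fin n)))))

/-- Weight `δ(f) = Pr[f(x) = -1]`. -/
def weight {n : ℕ} (f : (Fin n → Bool) → ℝ) : ℝ :=
  ((Finset.univ.filter (fun x : Fin n → Bool => f x = -1)).card : ℝ) / 2 ^ n

/-- Fourier max-supp-entropy `k'(f) = max_{S ∈ supp(f)} 1/|f̂(S)|`. -/
def maxSuppEntropy {n : ℕ} (f : (Fin n → Bool) → ℝ) : ℝ :=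
  sSup ((fun S => 1 / |fourierCoeff f S|) '' (fourierSupport f : Set (Finset (Fin n))))

/-- Dimension of the span of `{S : |f̂(S)| ≥ 1/t}`. -/
def levelDim {n : ℕ} (f : (Fin n → Bool) → ℝ) (t : ℝ) : ℕ :=
  Module.finrank (ZMod 2)
    ↥(Submodule.span (ZMod 2)
      (indicatorVec '' {S : Finset (Fin n) | 1 / t ≤ |fourierCoeff f S|}))

/-- Fourier max-rank-entropy `k''(f)`. -/
def maxRankEntropy {n : ℕ} (f : (Fin n → Bool) → ℝ) : ℝ :=
  sInf {t : ℝ | 0 < t ∧ levelDim f t = fourierRank f}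

/-- `f` is Boolean-valued (takes values in `{-1,1}`). -/
def IsBooleanFunc {n : ℕ} (f : (Fin n → Bool) → ℝ) : Prop := ∀ x, f x = 1 ∨ f x = -1

/-- The character `χ_S` on the hypercube, with integer values. -/
def intChar {n : ℕ} (S : Finset (Fin n)) (x : Fin n → Bool) : ℤ :=
  ∏ i ∈ S, if x i then -1 else 1

lemma cast_intChar {n : ℕ} (S : Finset (Fin n)) (x : Fin n → Bool) :
    (intChar S x : ℝ) = ∏ i ∈ S, signv (x i) := by
  simp [intChar, signv]

lemma intChar_update_not {n : ℕ} (S : Finset (Fin n)) (x : Fin n → Bool) (i : Fin n) :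
    intChar S (Function.update x i (!x i)) = if i ∈ S then -intChar S x else intChar S x := by
  unfold intChar
  split_ifs with h
  · rw [← Finset.mul_prod_erase S _ h, ← Finset.mul_prod_erase S _ h, ← neg_mul]
    congr 1
    · cases x i <;> simp
    · refine Finset.prod_congr rfl fun j hj => ?_
      rw [Function.update_of_ne (Finset.ne_of_mem_erase hj)]
  · refine Finset.prod_congr rfl fun j hj => ?_
    rw [Function.update_of_ne (ne_of_mem_of_not_mem hj h)]

/-- An integer combination of characters with an odd coefficient, all of whose values are
divisible by `2 ^ e`, has at least `2 ^ e` odd coefficients. -/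
lemma two_pow_le_card_odd {n : ℕ} (e : ℕ) (a : Finset (Fin n) → ℤ)
    (hdvd : ∀ x, (2 : ℤ) ^ e ∣ ∑ T, a T * intChar T x) (hodd : ∃ T, Odd (a T)) :
    2 ^ e ≤ (Finset.univ.filter fun T => Odd (a T)).card := by
  induction e generalizing a with
  | zero =>
    obtain ⟨T, hT⟩ := hodd
    exact Finset.card_pos.mpr ⟨T, by simpa using hT⟩
  | succ e ih =>
    obtain ⟨T, hT⟩ := hodd
    obtain ⟨U, hU, hUT⟩ : ∃ U, Odd (a U) ∧ U ≠ T := by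
      by_contra! h
      have hsum : (2 : ℤ) ∣ ∑ T, a T :=
        (dvd_pow_self 2 e.succ_ne_zero).trans (by simpa [intChar] using hdvd fun _ => false)
      rw [← Finset.add_sum_erase _ _ (Finset.mem_univ T)] at hsum
      have hrest : (2 : ℤ) ∣ ∑ U ∈ Finset.univ.erase T, a U := Finset.dvd_sum fun U hU =>
        even_iff_two_dvd.mp <| Int.not_odd_iff_even.mp fun hodd =>
          Finset.ne_of_mem_erase hU (h U hodd)
      exact Int.not_even_iff_odd.mpr hT (even_iff_two_dvd.mpr ((dvd_add_left hrest).mp hsum))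
    obtain ⟨i, hi⟩ : ∃ i, ¬(i ∈ U ↔ i ∈ T) := by
      by_contra! h
      exact hUT (Finset.ext h)
    have hflip : ∀ x, ∑ T, a T * intChar T (Function.update x i (!x i)) =
        ∑ T, (if i ∈ T then 0 else a T) * intChar T x -
          ∑ T, (if i ∈ T then a T else 0) * intChar T x := fun x => by
      rw [← Finset.sum_sub_distrib]
      refine Finset.sum_congr rfl fun T _ => ?_
      rw [intChar_update_not]
      split_ifs <;> ring
    have hadd : ∀ x, ∑ T, a T * intChar T x =
        ∑ T, (if i ∈ T then 0 else a T) * intChar T x +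
          ∑ T, (if i ∈ T then a T else 0) * intChar T x := fun x => by
      rw [← Finset.sum_add_distrib]
      refine Finset.sum_congr rfl fun T _ => ?_
      split_ifs <;> ring
    have hex : (∃ T, i ∈ T ∧ Odd (a T)) ∧ ∃ T, i ∉ T ∧ Odd (a T) := by
      by_cases h : i ∈ T
      · exact ⟨⟨T, h, hT⟩, U, by tauto, hU⟩
      · exact ⟨⟨U, by tauto, hU⟩, T, h, hT⟩
    obtain ⟨⟨V, hiV, hV⟩, W, hiW, hW⟩ := hex
    have hin := ih (fun T => if i ∈ T then a T else 0) (fun x => by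
      have h := dvd_sub (hdvd x) (hdvd (Function.update x i (!x i)))
      rw [hflip, hadd, add_sub_sub_cancel, ← two_mul, pow_succ'] at h
      exact (mul_dvd_mul_iff_left two_ne_zero).mp h) ⟨V, by simpa [hiV] using hV⟩
    have hout := ih (fun T => if i ∈ T then 0 else a T) (fun x => by
      have h := dvd_add (hdvd x) (hdvd (Function.update x i (!x i)))
      rw [hflip, hadd, add_add_sub_cancel, ← two_mul, pow_succ'] at h
      exact (mul_dvd_mul_iff_left two_ne_zero).mp h) ⟨W, by simpa [hiW] using hW⟩
    rw [pow_succ, mul_two]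
    refine (add_le_add hin hout).trans ?_
    rw [← Finset.card_union_of_disjoint]
    · refine Finset.card_le_card fun T => ?_
      by_cases h : i ∈ T <;> simp [h]
    · refine Finset.disjoint_left.mpr fun T => ?_
      by_cases h : i ∈ T <;> simp [h]

lemma sum_prod_signv_mul {n : ℕ} (x y : Fin n → Bool) :
    ∑ S : Finset (Fin n), (∏ i ∈ S, signv (x i)) * ∏ i ∈ S, signv (y i) =
      if x = y then 2 ^ n else 0 := by
  simp_rw [← Finset.prod_mul_distrib]
  rw [← Finset.powerset_univ, ← Finset.prod_one_add]
  split_ifs with h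
  · subst h
    have hone : ∀ i, 1 + signv (x i) * signv (x i) = 2 := fun i => by
      unfold signv
      split_ifs <;> norm_num
    simp [hone]
  · obtain ⟨i, hi⟩ := Function.ne_iff.mp h
    refine Finset.prod_eq_zero (Finset.mem_univ i) ?_
    cases hx : x i <;> cases hy : y i <;> simp_all [signv]

/-- Fourier inversion. -/
lemma sum_fourierCoeff_mul {n : ℕ} (f : (Fin n → Bool) → ℝ) (x : Fin n → Bool) :
    ∑ S, fourierCoeff f S * ∏ i ∈ S, signv (x i) = f x := by
  unfold fourierCoeff
  simp_rw [div_mul_eq_mul_div, Finset.sum_mul]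
  rw [← Finset.sum_div, Finset.sum_comm]
  simp_rw [mul_assoc, ← Finset.mul_sum, sum_prod_signv_mul]
  simp

lemma sum_fourierCoeff_sq {n : ℕ} {f : (Fin n → Bool) → ℝ} (hf : IsBooleanFunc f) :
    ∑ S, fourierCoeff f S ^ 2 = 1 := by
  have h : ∀ S, fourierCoeff f S ^ 2 =
      (∑ x, f x * (fourierCoeff f S * ∏ i ∈ S, signv (x i))) / 2 ^ n := fun S => by
    simp_rw [mul_left_comm (f _), ← Finset.mul_sum]
    rw [mul_div_assoc, sq]
    rfl
  simp_rw [h]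
  rw [← Finset.sum_div, Finset.sum_comm]
  simp_rw [← Finset.mul_sum, sum_fourierCoeff_mul]
  have hsq : ∀ x, f x * f x = 1 := fun x => by rcases hf x with h | h <;> simp [h]
  simp [hsq]

lemma exists_int_fourierCoeff {n : ℕ} {f : (Fin n → Bool) → ℝ} (hf : IsBooleanFunc f) :
    ∃ a : Finset (Fin n) → ℤ, ∀ T, fourierCoeff f T * 2 ^ n = a T := by
  have hz : ∀ x, ∃ z : ℤ, f x = z := fun x => by
    rcases hf x with h | h
    · exact ⟨1, by simp [h]⟩
    · exact ⟨-1, by simp [h]⟩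
  choose z hz using hz
  refine ⟨fun T => ∑ x, z x * intChar T x, fun T => ?_⟩
  rw [fourierCoeff, div_mul_cancel₀ _ (by positivity)]
  push_cast
  simp_rw [cast_intChar, hz]

/-- Scaling the Fourier coefficients by `2 ^ (d + 1)` to integers, one of them odd, forces
sparsity at least `2 ^ (d + 2)`. -/
lemma two_pow_le_sparsity {n : ℕ} {f : (Fin n → Bool) → ℝ} (hf : IsBooleanFunc f) {d : ℕ}
    {a : Finset (Fin n) → ℤ} (ha : ∀ T, fourierCoeff f T * 2 ^ (d + 1) = a T)
    (hodd : ∃ T, Odd (a T)) : 2 ^ (d + 2) ≤ sparsity f := by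
  have hval : ∀ x, ((∑ T, a T * intChar T x : ℤ) : ℝ) = f x * 2 ^ (d + 1) := fun x => by
    rw [← sum_fourierCoeff_mul f x, Finset.sum_mul]
    push_cast
    refine Finset.sum_congr rfl fun T _ => ?_
    rw [cast_intChar, ← ha]
    ring
  have hpar : ∀ T, Odd (a T - if T = ∅ then 2 ^ (d + 1) else 0) ↔ Odd (a T) := fun T => by
    have : Even (if T = ∅ then (2 : ℤ) ^ (d + 1) else 0) := by
      split_ifs
      · exact (even_two (α := ℤ)).pow_of_ne_zero d.succ_ne_zero
      · exact Even.zero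
    rw [Int.odd_sub]
    simp [this]
  have hcard := two_pow_le_card_odd (d + 2) (fun T => a T - if T = ∅ then 2 ^ (d + 1) else 0)
    (fun x => by
      have hsub : ∑ T, (a T - if T = ∅ then 2 ^ (d + 1) else 0) * intChar T x =
          ∑ T, a T * intChar T x - 2 ^ (d + 1) := by
        simp [sub_mul, Finset.sum_sub_distrib, intChar]
      rw [hsub]
      have hv := hval x
      rcases hf x with h | h
      · have : ∑ T, a T * intChar T x = 2 ^ (d + 1) := by
          rw [h, one_mul] at hv
          exact_mod_cast hv
        simp [this]
      · have : ∑ T, a T * intChar T x = -2 ^ (d + 1) := by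
          rw [h, neg_one_mul] at hv
          exact_mod_cast hv
        exact ⟨-1, by rw [this]; ring⟩)
    (hodd.imp fun T => (hpar T).mpr)
  refine hcard.trans (Finset.card_le_card fun T hT => ?_)
  have hT' : Odd (a T) := (hpar T).mp (by simpa using hT)
  refine Finset.mem_filter.mpr ⟨Finset.mem_univ T, fun h0 => ?_⟩
  have h := ha T
  rw [h0, zero_mul] at h
  have : a T = 0 := by exact_mod_cast h.symm
  simp [this] at hT'

/-- Nonzero Fourier coefficients of a Boolean function of sparsity `k ≥ 2` are at least `2 / k`
in absolute value. -/
lemma two_le_sparsity_mul_abs_fourierCoeff {n : ℕ} {f : (Fin n → Bool) → ℝ}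
    (hf : IsBooleanFunc f) (hk : 2 ≤ sparsity f) {S : Finset (Fin n)}
    (hS : fourierCoeff f S ≠ 0) : 2 ≤ (sparsity f : ℝ) * |fourierCoeff f S| := by
  have hex : ∃ d : ℕ, ∃ a : Finset (Fin n) → ℤ, ∀ T, fourierCoeff f T * 2 ^ d = a T :=
    ⟨n, exists_int_fourierCoeff hf⟩
  have hmin := fun m => Nat.find_min hex (m := m)
  obtain ⟨a, ha⟩ := Nat.find_spec hex
  generalize Nat.find hex = d at ha hmin
  have hpow : 2 ^ (d + 1) ≤ sparsity f := by
    cases d with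
    | zero => simpa using hk
    | succ d =>
      refine two_pow_le_sparsity hf ha ?_
      by_contra! h
      choose b hb using fun T => (Int.not_odd_iff_even.mp (h T)).two_dvd
      refine hmin d d.lt_succ_self ⟨b, fun T => ?_⟩
      have h2 := ha T
      rw [hb, pow_succ] at h2
      push_cast at h2
      linarith
  have habs : 1 ≤ |fourierCoeff f S| * 2 ^ d := by
    have hne : a S ≠ 0 := fun h0 => by
      have := ha S
      simp [h0, hS] at this
    have hone : (1 : ℝ) ≤ |(a S : ℝ)| := by exact_mod_cast Int.one_le_abs hne
    rwa [← ha, abs_mul, abs_of_pos (by positivity : (0 : ℝ) < 2 ^ d)] at hone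
  calc (2 : ℝ) ≤ 2 * (|fourierCoeff f S| * 2 ^ d) := by linarith
    _ = 2 ^ (d + 1) * |fourierCoeff f S| := by ring
    _ ≤ sparsity f * |fourierCoeff f S| := by
      gcongr
      exact_mod_cast hpow

lemma exists_sparsity_mul_sq_le_one {n : ℕ} {f : (Fin n → Bool) → ℝ} (hf : IsBooleanFunc f)
    (hk : 0 < sparsity f) :
    ∃ S ∈ fourierSupport f, sparsity f * fourierCoeff f S ^ 2 ≤ 1 := by
  obtain ⟨S, hS, hmin⟩ := Finset.exists_min_image (fourierSupport f)
    (fun S => fourierCoeff f S ^ 2) (Finset.card_pos.mp hk)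
  refine ⟨S, hS, ?_⟩
  rw [← sum_fourierCoeff_sq hf, sparsity, ← nsmul_eq_mul]
  exact (Finset.card_nsmul_le_sum _ _ _ hmin).trans
    (Finset.sum_le_univ_sum_of_nonneg fun T => sq_nonneg _)

/-- **Lemma.** For every Boolean function `f` with `k(f) ≥ 2`,
`√(k(f)) ≤ k'(f) ≤ k(f)/2`. -/
theorem maxSuppEntropy_bounds
    (n : ℕ) (hn : 0 < n) (f : (Fin n → Bool) → ℝ) (hf : IsBooleanFunc f)
    (hk : 2 ≤ sparsity f) :
    Real.sqrt (sparsity f) ≤ maxSuppEntropy f ∧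
    maxSuppEntropy f ≤ (sparsity f : ℝ) / 2 := by
  constructor
  · obtain ⟨S, hS, hle⟩ := exists_sparsity_mul_sq_le_one hf (by omega)
    have hpos : 0 < |fourierCoeff f S| := abs_pos.mpr (Finset.mem_filter.mp hS).2
    refine le_trans ?_ (le_csSup (((fourierSupport f).finite_toSet.image _).bddAbove)
      (Set.mem_image_of_mem _ hS))
    refine Real.sqrt_le_iff.mpr ⟨by positivity, ?_⟩
    rwa [div_pow, one_pow, sq_abs, le_div_iff₀ (by rw [← sq_abs]; positivity)]
  · refine csSup_le ((Finset.coe_nonempty.mpr (Finset.card_pos.mp (by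
      change 0 < sparsity f
      omega))).image _) ?_
    rintro _ ⟨S, hS, rfl⟩
    have hS0 : fourierCoeff f S ≠ 0 := (Finset.mem_filter.mp hS).2
    have h := two_le_sparsity_mul_abs_fourierCoeff hf hk hS0
    refine (div_le_iff₀ (abs_pos.mpr hS0)).mpr ?_
    linarith

end BoolFunc

end
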